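/- Let F be a field, let 1 ≤ k ≤ n, let V ∈ F^{k×n} be an MDS matrix (every k columns linearly independent), and let Q ∈ F^{(n−k)×n} be a dual matrix of V (rank n−k with V · Qᵀ = 0). Fix ℓ ≥ 2. Then the following are equivalent: (i) for every family A_1,…,A_ℓ of subsets of {1,…,n} with |A_i| ≤ n−k for all i, |A_1| + ⋯ + |A_ℓ| = (ℓ−1)·(n−k), and the dimension-(n−k) null intersection property, the column-span intersection Q_{A_1} ∩ ⋯ ∩ Q_{A_ℓ} is zero; (ii) for every such family, writing Ā_i := {1,…,n} ∖ A_i, the (n + ℓk) × (n + (ℓ−1)k) block matrix whose top n rows are the horizontal concatenation [I_n|_{Ā_1} I_n|_{Ā_2} ⋯ I_n|_{Ā_ℓ}] (columns of the n×n identity indexed by Ā_i) and whose remaining ℓ blocks of k rows each form the block diagonal with blocks V|_{Ā_1}, …, V|_{Ā_ℓ}, has rank n + (ℓ−1)k. -/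

import Mathlib

open Finset Matrix

noncomputable section

/-- The intersection `⋂_{j ∈ p} A j`, as a `Finset (Fin n)`. -/
def interSet {ℓ n : ℕ} (A : Fin ℓ → Finset (Fin n)) (p : Finset (Fin ℓ)) : Finset (Fin n) :=
  Finset.univ.filter fun x => ∀ j ∈ p, x ∈ A j

/-- The dimension-`m` null intersection property: for every partition of `{1,…,ℓ}`
(presented as a `Finpartition` of `Finset.univ : Finset (Fin ℓ)`) into nonempty parts
`P_1,…,P_s`, we have `Σ_i |⋂_{j ∈ P_i} A_j| ≤ (s-1)·m`. -/
def NullInter {ℓ n : ℕ} (m : ℕ) (A : Fin ℓ → Finset (Fin n)) : Prop :=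
  ∀ P : Finpartition (Finset.univ : Finset (Fin ℓ)),
    ∑ p ∈ P.parts, (interSet A p).card ≤ (P.parts.card - 1) * m

/-- Span of the columns of `M` indexed by `A`. -/
def colSpan {K : Type*} [Field K] {k n : ℕ} (M : Matrix (Fin k) (Fin n) K)
    (A : Finset (Fin n)) : Submodule K (Fin k → K) :=
  Submodule.span K ((fun j i => M i j) '' (A : Set (Fin n)))

/-- Span of the first `σ` columns of `M`. -/
def colSpanLT {K : Type*} [Field K] {k b : ℕ} (M : Matrix (Fin k) (Fin b) K)
    (σ : ℕ) : Submodule K (Fin k → K) :=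
  Submodule.span K ((fun j i => M i j) '' {j : Fin b | (j : ℕ) < σ})

/-- The minimum of `σ` over the set `p` (for nonempty `p`, this is `min_{j ∈ p} σ j`). -/
def partMin {ℓ : ℕ} (σ : Fin ℓ → ℕ) (p : Finset (Fin ℓ)) : ℕ :=
  sInf (σ '' (p : Set (Fin ℓ)))

/-- The generic intersection dimension `gid_m((σ_i, A_i)_i)`: the maximum over all
partitions of `{1,…,ℓ}` into nonempty parts `P_1,…,P_s` of
`-m(s-1) + Σ_i (min_{j ∈ P_i} σ_j + |⋂_{j ∈ P_i} A_j|)`. -/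
def gid {ℓ n : ℕ} (m : ℕ) (σ : Fin ℓ → ℕ) (A : Fin ℓ → Finset (Fin n)) : ℤ :=
  sSup { v : ℤ | ∃ P : Finpartition (Finset.univ : Finset (Fin ℓ)),
    v = -(m : ℤ) * ((P.parts.card : ℤ) - 1)
      + ∑ p ∈ P.parts, ((partMin σ p : ℤ) + ((interSet A p).card : ℤ)) }

/-- The `(n + ℓk) × (n + (ℓ-1)k)` block matrix whose top `n` rows are the horizontal
concatenation of the columns of the identity indexed by `Ā_i = (A i)ᶜ`, and whose
remaining `ℓ` blocks of `k` rows form the block diagonal with blocks `V|_{Ā_i}`. -/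
def blockMat {F : Type*} [Field F] {k n ℓ : ℕ} (V : Matrix (Fin k) (Fin n) F)
    (A : Fin ℓ → Finset (Fin n)) :
    Matrix (Fin n ⊕ Fin ℓ × Fin k) ((i : Fin ℓ) × {j : Fin n // j ∈ (A i)ᶜ}) F :=
  Matrix.of fun r c =>
    match r with
    | Sum.inl x => if x = c.2.1 then 1 else 0
    | Sum.inr (i, t) => if i = c.1 then V t c.2.1 else 0

section Aux

variable {F : Type*} [Field F] {k n : ℕ}

/-- Orthogonal matrices of complementary rank: kernel of one is the range of the transpose
of the other. -/
theorem aux_ker_eq_range {a b : ℕ} (M : Matrix (Fin a) (Fin n) F) (N : Matrix (Fin b) (Fin n) F)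
    (h : M * Nᵀ = 0) (hr : M.rank + N.rank = n) :
    LinearMap.range Nᵀ.mulVecLin = LinearMap.ker M.mulVecLin := by
  apply Submodule.eq_of_le_of_finrank_eq
  · rintro _ ⟨y, rfl⟩
    rw [LinearMap.mem_ker, Matrix.mulVecLin_apply, Matrix.mulVecLin_apply, Matrix.mulVec_mulVec, h,
      Matrix.zero_mulVec]
  · have h1 := LinearMap.finrank_range_add_finrank_ker M.mulVecLin
    have h2 : Module.finrank F (LinearMap.range Nᵀ.mulVecLin) = N.rank := by
      rw [← Matrix.rank_transpose N]; rfl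
    have h3 : Module.finrank F (LinearMap.range M.mulVecLin) = M.rank := rfl
    rw [Module.finrank_fin_fun] at h1
    omega

theorem aux_V_span (hk : 1 ≤ k) (V : Matrix (Fin k) (Fin n) F)
    (hMDS : ∀ S : Finset (Fin n), S.card = k →
      LinearIndependent F (fun j : S => fun i => V i (j : Fin n)))
    (S : Finset (Fin n)) (hS : S.card = k) :
    Submodule.span F (Set.range (fun j : S => fun i => V i (j : Fin n))) = ⊤ := by
  have : Nonempty S := by
    rw [Finset.nonempty_coe_sort, ← Finset.card_pos]; omega
  apply (hMDS S hS).span_eq_top_of_card_eq_finrank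
  simp [hS]

theorem aux_V_rank (hk : 1 ≤ k) (hkn : k ≤ n) (V : Matrix (Fin k) (Fin n) F)
    (hMDS : ∀ S : Finset (Fin n), S.card = k →
      LinearIndependent F (fun j : S => fun i => V i (j : Fin n))) : V.rank = k := by
  obtain ⟨S, -, hS⟩ := Finset.exists_subset_card_eq (s := (Finset.univ : Finset (Fin n)))
    (n := k) (by simpa using hkn)
  have h := aux_V_span hk V hMDS S hS
  rw [Matrix.rank_eq_finrank_span_cols]
  have : Submodule.span F (Set.range V.col) = ⊤ := by
    rw [eq_top_iff, ← h]
    apply Submodule.span_mono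
    rintro _ ⟨j, rfl⟩
    exact ⟨j, rfl⟩
  rw [this]; simp

theorem aux_Q_indep (hk : 1 ≤ k) (hkn : k ≤ n) (V : Matrix (Fin k) (Fin n) F)
    (hMDS : ∀ S : Finset (Fin n), S.card = k →
      LinearIndependent F (fun j : S => fun i => V i (j : Fin n)))
    (Q : Matrix (Fin (n - k)) (Fin n) F) (hQrank : Q.rank = n - k) (hQ : V * Qᵀ = 0)
    (A : Finset (Fin n)) (hA : A.card ≤ n - k) :
    Module.finrank F (colSpan Q A) = A.card := by
  have hV := aux_V_rank hk hkn V hMDS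
  have hQ' : Q * Vᵀ = 0 := by
    rw [← Matrix.transpose_transpose (Q * Vᵀ), Matrix.transpose_mul, Matrix.transpose_transpose,
      hQ, Matrix.transpose_zero]
  have hker := aux_ker_eq_range Q V hQ' (by omega)
  have hli : LinearIndependent F (fun j : A => fun i => Q i (j : Fin n)) := by
    rw [Fintype.linearIndependent_iff]
    intro g hg
    let c : Fin n → F := fun j => if h : j ∈ A then g ⟨j, h⟩ else 0
    have hc : c ∈ LinearMap.ker Q.mulVecLin := by
      rw [LinearMap.mem_ker, ← hg]
      ext t
      simp only [Matrix.mulVecLin_apply, Matrix.mulVec, dotProduct, Finset.sum_apply,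
        Pi.smul_apply, smul_eq_mul]
      rw [← Finset.sum_subset (Finset.subset_univ A), ← Finset.sum_coe_sort A]
      · apply Finset.sum_congr rfl
        intro j _
        simp [c, mul_comm]
      · intro j _ hj
        simp [c, hj]
    rw [← hker] at hc
    obtain ⟨z, hz⟩ := hc
    obtain ⟨S, hSA, hS⟩ := Finset.exists_subset_card_eq (s := Aᶜ)
      (n := k) (by rw [Finset.card_compl, Fintype.card_fin]; omega)
    have hspan := aux_V_span hk V hMDS S hS
    have hzero : ∀ w : Fin k → F, w ⬝ᵥ z = 0 := by
      intro w
      have hw : w ∈ Submodule.span F (Set.range (fun j : S => fun i => V i (j : Fin n))) := by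
        rw [hspan]; trivial
      induction hw using Submodule.span_induction with
      | mem x hx =>
        obtain ⟨j, rfl⟩ := hx
        have hj : (j : Fin n) ∉ A := Finset.mem_compl.1 (hSA j.2)
        have := congrFun hz j
        simp only [c, hj] at this
        exact this
      | zero => simp
      | add x y _ _ hx hy => rw [add_dotProduct, hx, hy, add_zero]
      | smul a x _ hx => rw [smul_dotProduct, hx, smul_zero]
    have hz0 : z = 0 := by
      ext i
      have := hzero (Pi.single i 1)
      simpa using this
    intro j
    have := congrFun hz j
    simp [hz0, c] at this
    exact this.symm
  have := finrank_span_eq_card hli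
  rw [Fintype.card_coe] at this
  rw [← this]
  have hset : (fun j i => Q i j) '' (A : Set (Fin n))
      = Set.range (fun j : A => fun i => Q i (j : Fin n)) := by
    ext v
    simp
  unfold colSpan
  rw [hset]

/-- Evaluate a functional at the columns of `Q`. -/
def evalCols {m : ℕ} (Q : Matrix (Fin m) (Fin n) F) :
    Module.Dual F (Fin m → F) →ₗ[F] (Fin n → F) :=
  LinearMap.pi fun j => Module.Dual.eval F (Fin m → F) (Q.col j)

theorem evalCols_apply {m : ℕ} (Q : Matrix (Fin m) (Fin n) F) (φ : Module.Dual F (Fin m → F))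
    (j : Fin n) : evalCols Q φ j = φ (Q.col j) := rfl

theorem evalCols_injective {m : ℕ} (Q : Matrix (Fin m) (Fin n) F) (hQ : Q.rank = m) :
    Function.Injective (evalCols Q) := by
  rw [injective_iff_map_eq_zero]
  intro φ hφ
  have hspan : Submodule.span F (Set.range Q.col) = ⊤ := by
    apply Submodule.eq_top_of_finrank_eq
    rw [← Matrix.rank_eq_finrank_span_cols, hQ]; simp
  apply LinearMap.ext_on_range hspan
  intro j
  exact congrFun hφ j

theorem evalCols_range (Q : Matrix (Fin (n - k)) (Fin n) F) (V : Matrix (Fin k) (Fin n) F)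
    (hQrank : Q.rank = n - k) (hQ : V * Qᵀ = 0) (hV : V.rank = k) :
    LinearMap.range (evalCols Q) = LinearMap.ker V.mulVecLin := by
  apply Submodule.eq_of_le_of_finrank_eq
  · rintro _ ⟨φ, rfl⟩
    rw [LinearMap.mem_ker]
    ext t
    have h0 : ∑ j, V t j • Q.col j = 0 := by
      ext s
      have := congrFun (congrFun hQ t) s
      simpa [Matrix.mul_apply] using this
    have := congrArg φ h0
    rw [map_sum, map_zero] at this
    simp only [map_smul, smul_eq_mul] at this
    exact this
  · rw [LinearMap.finrank_range_of_inj (evalCols_injective Q hQrank)]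
    have h1 := LinearMap.finrank_range_add_finrank_ker V.mulVecLin
    have h3 : Module.finrank F (LinearMap.range V.mulVecLin) = V.rank := rfl
    rw [Module.finrank_fin_fun] at h1
    rw [Subspace.dual_finrank_eq, Module.finrank_fin_fun]
    omega

theorem mem_colSpan_annihilator {m : ℕ} (Q : Matrix (Fin m) (Fin n) F) (A : Finset (Fin n))
    (φ : Module.Dual F (Fin m → F)) :
    φ ∈ (colSpan Q A).dualAnnihilator ↔ ∀ j ∈ A, evalCols Q φ j = 0 := by
  rw [Submodule.mem_dualAnnihilator]
  constructor
  · intro h j hj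
    exact h _ (Submodule.subset_span ⟨j, hj, rfl⟩)
  · intro h w hw
    induction hw using Submodule.span_induction with
    | mem x hx =>
      obtain ⟨j, hj, rfl⟩ := hx
      exact h j hj
    | zero => simp
    | add x y _ _ hx hy => rw [map_add, hx, hy, add_zero]
    | smul a x _ hx => rw [map_smul, hx, smul_zero]

/-- The sum map on a product of subspaces. -/
def sumMap {ℓ : ℕ} {W : Type*} [AddCommGroup W] [Module F W] (U : Fin ℓ → Submodule F W) :
    ((i : Fin ℓ) → U i) →ₗ[F] W :=
  ∑ i, (U i).subtype ∘ₗ LinearMap.proj i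

theorem sumMap_apply {ℓ : ℕ} {W : Type*} [AddCommGroup W] [Module F W]
    (U : Fin ℓ → Submodule F W) (x : (i : Fin ℓ) → U i) :
    sumMap U x = ∑ i, (x i : W) := by
  simp [sumMap]

theorem sumMap_surjective {ℓ : ℕ} {W : Type*} [AddCommGroup W] [Module F W]
    (U : Fin ℓ → Submodule F W) : Function.Surjective (sumMap U) ↔ ⨆ i, U i = ⊤ := by
  rw [← LinearMap.range_eq_top]
  have : LinearMap.range (sumMap U) = ⨆ i, U i := by
    apply le_antisymm
    · rintro _ ⟨x, rfl⟩
      rw [sumMap_apply]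
      exact Submodule.sum_mem _ fun i _ => Submodule.mem_iSup_of_mem i (x i).2
    · apply iSup_le
      intro i w hw
      refine ⟨Pi.single i ⟨w, hw⟩, ?_⟩
      rw [sumMap_apply, Finset.sum_eq_single i]
      · simp
      · intro j _ hj
        simp [Pi.single_eq_of_ne hj]
      · simp
  rw [this]

theorem sumMap_injective {ℓ : ℕ} {W : Type*} [AddCommGroup W] [Module F W]
    [FiniteDimensional F W] (U : Fin ℓ → Submodule F W)
    (h : ∑ i, Module.finrank F (U i) = Module.finrank F W) :
    Function.Injective (sumMap U) ↔ ⨆ i, U i = ⊤ := by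
  rw [← sumMap_surjective]
  apply LinearMap.injective_iff_surjective_of_finrank_eq_finrank
  rw [← h, Module.finrank_pi_fintype]

/-- Extension by zero of the `i`-th block. -/
def extBlock {ℓ : ℕ} (A : Fin ℓ → Finset (Fin n))
    (x : ((i : Fin ℓ) × {j : Fin n // j ∈ (A i)ᶜ}) → F) (i : Fin ℓ) (j : Fin n) : F :=
  if h : j ∈ (A i)ᶜ then x ⟨i, ⟨j, h⟩⟩ else 0

theorem blockMat_inl {ℓ : ℕ} (V : Matrix (Fin k) (Fin n) F) (A : Fin ℓ → Finset (Fin n))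
    (x : ((i : Fin ℓ) × {j : Fin n // j ∈ (A i)ᶜ}) → F) (j : Fin n) :
    (blockMat V A *ᵥ x) (Sum.inl j) = ∑ i, extBlock A x i j := by
  simp only [Matrix.mulVec, dotProduct, blockMat, Matrix.of_apply]
  rw [Fintype.sum_sigma]
  apply Finset.sum_congr rfl
  intro i _
  unfold extBlock
  split_ifs with h
  · rw [Finset.sum_eq_single ⟨j, h⟩]
    · simp
    · rintro ⟨b, hb⟩ _ hne
      have : j ≠ b := fun e => hne (by subst e; rfl)
      simp [this]
    · simp
  · apply Finset.sum_eq_zero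
    rintro ⟨b, hb⟩ _
    have : j ≠ b := fun e => h (by subst e; exact hb)
    simp [this]

theorem blockMat_inr {ℓ : ℕ} (V : Matrix (Fin k) (Fin n) F) (A : Fin ℓ → Finset (Fin n))
    (x : ((i : Fin ℓ) × {j : Fin n // j ∈ (A i)ᶜ}) → F) (i : Fin ℓ) (t : Fin k) :
    (blockMat V A *ᵥ x) (Sum.inr (i, t)) = (V *ᵥ extBlock A x i) t := by
  simp only [Matrix.mulVec, dotProduct, blockMat, Matrix.of_apply]
  rw [Fintype.sum_sigma, Finset.sum_eq_single i]
  · rw [← Finset.sum_subset (Finset.subset_univ (A i)ᶜ), ← Finset.sum_coe_sort (A i)ᶜ]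
    · apply Finset.sum_congr rfl
      rintro ⟨j, hj⟩ _
      simp only [extBlock, hj, if_true, dif_pos]
    · intro j _ hj
      simp only [extBlock, hj, dif_neg, not_false_eq_true, mul_zero]
  · intro b _ hb
    apply Finset.sum_eq_zero
    intro j _
    simp [hb.symm]
  · simp

theorem aux_ker_iff {ℓ : ℕ} (V : Matrix (Fin k) (Fin n) F) (hV : V.rank = k)
    (Q : Matrix (Fin (n - k)) (Fin n) F) (hQrank : Q.rank = n - k) (hQ : V * Qᵀ = 0)
    (A : Fin ℓ → Finset (Fin n)) :
    Function.Injective (sumMap fun i => (colSpan Q (A i)).dualAnnihilator) ↔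
      LinearMap.ker (blockMat V A).mulVecLin = ⊥ := by
  have hinj := evalCols_injective Q hQrank
  have hrange := evalCols_range Q V hQrank hQ hV
  rw [injective_iff_map_eq_zero, LinearMap.ker_eq_bot']
  constructor
  · intro h x hx
    rw [Matrix.mulVecLin_apply] at hx
    have hex : ∀ i, ∃ φ, evalCols Q φ = extBlock A x i := by
      intro i
      have : extBlock A x i ∈ LinearMap.range (evalCols Q) := by
        rw [hrange, LinearMap.mem_ker]
        ext t
        rw [Matrix.mulVecLin_apply, ← blockMat_inr, hx]; rfl
      exact this
    choose φ hφ using hex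
    have hmem : ∀ i, φ i ∈ (colSpan Q (A i)).dualAnnihilator := by
      intro i
      rw [mem_colSpan_annihilator]
      intro j hj
      rw [hφ]
      simp [extBlock, hj]
    have h0 := h (fun i => ⟨φ i, hmem i⟩) (by
      rw [sumMap_apply]
      apply hinj
      rw [map_sum, map_zero]
      ext j
      simp only [hφ, Finset.sum_apply]
      rw [← blockMat_inl V, hx]; rfl)
    ext ⟨i, j, hj⟩
    have h1 : φ i = 0 := congrArg Subtype.val (congrFun h0 i)
    have h2 := congrFun (hφ i) j
    rw [h1, map_zero] at h2
    unfold extBlock at h2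
    rw [dif_pos hj] at h2
    exact h2.symm
  · intro h φ hφ
    rw [sumMap_apply] at hφ
    let x : ((i : Fin ℓ) × {j : Fin n // j ∈ (A i)ᶜ}) → F := fun c => evalCols Q (φ c.1) c.2.1
    have hext : ∀ i, extBlock A x i = evalCols Q (φ i) := by
      intro i
      ext j
      unfold extBlock
      split_ifs with hj
      · rfl
      · exact ((mem_colSpan_annihilator Q (A i) (φ i)).1 (φ i).2 j (by simpa using hj)).symm
    have hx : x = 0 := by
      apply h
      rw [Matrix.mulVecLin_apply]
      ext r
      rcases r with j | ⟨i, t⟩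
      · rw [blockMat_inl]
        simp only [hext]
        have := congrFun (congrArg (evalCols Q) hφ) j
        rw [map_sum, Finset.sum_apply, map_zero] at this
        exact this
      · rw [blockMat_inr, hext]
        have : evalCols Q (φ i) ∈ LinearMap.ker V.mulVecLin := by
          rw [← hrange]; exact ⟨_, rfl⟩
        exact congrFun this t
    ext1 i
    apply Subtype.ext
    apply hinj
    rw [← hext, hx]
    ext j
    simp [extBlock]

theorem aux_rank_iff {m c : Type*} [Fintype m] [Fintype c] (M : Matrix m c F) (N : ℕ)
    (hN : Fintype.card c = N) : LinearMap.ker M.mulVecLin = ⊥ ↔ M.rank = N := by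
  have h1 := LinearMap.finrank_range_add_finrank_ker M.mulVecLin
  have h3 : Module.finrank F (LinearMap.range M.mulVecLin) = M.rank := rfl
  rw [Module.finrank_fintype_fun_eq_card] at h1
  rw [← Submodule.finrank_eq_zero (R := F)]
  omega

theorem aux_main (hk : 1 ≤ k) (hkn : k ≤ n) (V : Matrix (Fin k) (Fin n) F)
    (hMDS : ∀ S : Finset (Fin n), S.card = k →
      LinearIndependent F (fun j : S => fun i => V i (j : Fin n)))
    (Q : Matrix (Fin (n - k)) (Fin n) F) (hQrank : Q.rank = n - k) (hQ : V * Qᵀ = 0)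
    (ℓ : ℕ) (hℓ : 2 ≤ ℓ) (A : Fin ℓ → Finset (Fin n))
    (hA : ∀ i, (A i).card ≤ n - k) (hsum : (∑ i, (A i).card) = (ℓ - 1) * (n - k)) :
    (⨅ i, colSpan Q (A i)) = ⊥ ↔ (blockMat V A).rank = n + (ℓ - 1) * k := by
  have hV := aux_V_rank hk hkn V hMDS
  obtain ⟨p, rfl⟩ : ∃ p, ℓ = p + 1 := ⟨ℓ - 1, by omega⟩
  obtain ⟨d, rfl⟩ : ∃ d, n = k + d := ⟨n - k, by omega⟩
  simp only [Nat.add_sub_cancel] at hsum ⊢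
  have hfin : ∑ i, Module.finrank F (colSpan Q (A i)).dualAnnihilator
      = Module.finrank F (Module.Dual F (Fin (k + d - k) → F)) := by
    rw [Subspace.dual_finrank_eq, Module.finrank_fin_fun]
    have h : ∑ i, ((A i).card + Module.finrank F (colSpan Q (A i)).dualAnnihilator)
        = ∑ i : Fin (p + 1), (k + d - k) := by
      apply Finset.sum_congr rfl
      intro i _
      rw [← aux_Q_indep hk hkn V hMDS Q hQrank hQ (A i) (hA i),
        Subspace.finrank_add_finrank_dualAnnihilator_eq, Module.finrank_fin_fun]
    rw [Finset.sum_add_distrib, hsum] at h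
    simp only [Finset.sum_const, Finset.card_univ, Fintype.card_fin, smul_eq_mul] at h
    rw [add_mul, one_mul] at h
    omega
  have hiff := sumMap_injective (fun i => (colSpan Q (A i)).dualAnnihilator) hfin
  rw [← aux_rank_iff, ← aux_ker_iff V hV Q hQrank hQ A]
  · refine Iff.trans ?_ hiff.symm
    rw [← Subspace.dualAnnihilator_iInf_eq, ← Submodule.dualAnnihilator_bot,
      Subspace.dualAnnihilator_inj]
  · rw [Fintype.card_sigma]
    have h : ∑ i, ((A i).card + Fintype.card {j // j ∈ (A i)ᶜ})
        = ∑ i : Fin (p + 1), (k + d) := by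
      apply Finset.sum_congr rfl
      intro i _
      rw [Fintype.card_coe, Finset.card_add_card_compl, Fintype.card_fin]
    rw [Finset.sum_add_distrib, hsum] at h
    simp only [Finset.sum_const, Finset.card_univ, Fintype.card_fin, smul_eq_mul] at h
    rw [Nat.add_sub_cancel_left] at h
    nlinarith

end Aux

/-- For an MDS matrix `V` with dual matrix `Q`, the dual code is `MDS(ℓ)` (all
null-intersection column-span intersections of `Q` vanish) if and only if the
corresponding block matrices have full rank `n + (ℓ-1)k`. -/
theorem dual_MDS_iff_blockMat_rank
    (F : Type*) [Field F] (k n : ℕ) (hk : 1 ≤ k) (hkn : k ≤ n)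
    (V : Matrix (Fin k) (Fin n) F)
    (hMDS : ∀ S : Finset (Fin n), S.card = k →
      LinearIndependent F (fun j : S => fun i => V i (j : Fin n)))
    (Q : Matrix (Fin (n - k)) (Fin n) F) (hQrank : Q.rank = n - k) (hQ : V * Qᵀ = 0)
    (ℓ : ℕ) (hℓ : 2 ≤ ℓ) :
    (∀ A : Fin ℓ → Finset (Fin n),
        (∀ i, (A i).card ≤ n - k) →
        (∑ i, (A i).card) = (ℓ - 1) * (n - k) →
        NullInter (n - k) A →
        (⨅ i, colSpan Q (A i)) = ⊥)
    ↔ (∀ A : Fin ℓ → Finset (Fin n),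
        (∀ i, (A i).card ≤ n - k) →
        (∑ i, (A i).card) = (ℓ - 1) * (n - k) →
        NullInter (n - k) A →
        (blockMat V A).rank = n + (ℓ - 1) * k) := by
  constructor
  · intro h A h1 h2 h3
    exact (aux_main hk hkn V hMDS Q hQrank hQ ℓ hℓ A h1 h2).1 (h A h1 h2 h3)
  · intro h A h1 h2 h3
    exact (aux_main hk hkn V hMDS Q hQrank hQ ℓ hℓ A h1 h2).2 (h A h1 h2 h3)
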